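/- arXiv:2509.12538 — 2 statements merged into one kernel-verified Lean document; each statement's English description precedes it below -/
import Mathlib

section
/- Reduced-form identity for the always-taker outcome term. Assume Assumptions IV, SM and IRR hold. Then Δ^{01}_{00}E[Y_i D_i D_{(i)}^∨] = −E[Y_i(1,0) · 1_E], where E is the event {D_i(0,1) = D_i(0,0) = 1, D_{(i)}(0,1) ≠ D_{(i)}(0,0) = 0} and Y_i(1,0) is the potential outcome with own treatment 1 and all peers untreated. -/
open MeasureTheory ProbabilityTheory

noncomputable section

/-- Real value of a Boolean indicator. -/
def b2r (b : Bool) : ℝ := if b then 1 else 0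

variable {Ω : Type*} {m : ℕ}

/-- Conditional expectation of `X` given the event `A`, i.e. `E[X·1_A]/P(A)`. -/
def cexp [MeasurableSpace Ω] (P : Measure Ω) (X : Ω → ℝ) (A : Set Ω) : ℝ :=
  (∫ ω in A, X ω ∂P) / (P A).toReal

/-- The event `{Z_i = z, Z_{(i)} = z'}` (all peer instruments equal `z'`). -/
def ZevM (Zi : Ω → Bool) (Zp : Ω → Fin m → Bool) (z z' : Bool) : Set Ω :=
  {ω | Zi ω = z ∧ ∀ j, Zp ω j = z'}

/-- `Δ^{zz'}_{ww'} E[X]`, where `X z z'` is the observed quantity under the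
instrument pattern `(z, z')`. -/
def dEM [MeasurableSpace Ω] (P : Measure Ω) (Zi : Ω → Bool) (Zp : Ω → Fin m → Bool)
    (X : Bool → Bool → Ω → ℝ) (z z' w w' : Bool) : ℝ :=
  cexp P (X z z') (ZevM Zi Zp z z') - cexp P (X w w') (ZevM Zi Zp w w')

/-- Conditioning on an event of an independent variable does not change the expectation. -/
theorem cexp_preimage_eq_integral_of_indepFun {Ω α β : Type*} [MeasurableSpace Ω]
    [MeasurableSpace α] [MeasurableSpace β] {P : Measure Ω} [IsProbabilityMeasure P]
    {U : Ω → α} {V : Ω → β} (hU : Measurable U) (hV : Measurable V) (hUV : IndepFun U V P)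
    {s : Set α} (hs : MeasurableSet s) (hpos : 0 < P (U ⁻¹' s)) {g : β → ℝ} (hg : Measurable g) :
    cexp P (fun ω => g (V ω)) (U ⁻¹' s) = ∫ ω, g (V ω) ∂P := by
  have hne : (P (U ⁻¹' s)).toReal ≠ 0 :=
    (ENNReal.toReal_pos hpos.ne' (measure_ne_top _ _)).ne'
  have hone : Measurable (s.indicator (fun _ => (1 : ℝ))) := measurable_const.indicator hs
  have h := (hUV.comp hone hg).integral_fun_mul_eq_mul_integral
    (hone.comp hU).aestronglyMeasurable (hg.comp hV).aestronglyMeasurable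
  have h₁ : ∫ ω, (s.indicator (fun _ => (1 : ℝ)) ∘ U) ω ∂P = (P (U ⁻¹' s)).toReal := by
    have : s.indicator (fun _ => (1 : ℝ)) ∘ U = (U ⁻¹' s).indicator 1 := rfl
    rw [this, integral_indicator_one (hU hs)]
    rfl
  have h₂ : ∫ ω in U ⁻¹' s, g (V ω) ∂P =
      ∫ ω, (s.indicator (fun _ => (1 : ℝ)) ∘ U) ω * (g ∘ V) ω ∂P := by
    rw [← integral_indicator (hU hs)]
    congr 1
    ext ω
    by_cases hω : U ω ∈ s <;> simp [Set.indicator, hω]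
  rw [cexp, h₂, h, h₁, mul_div_cancel_left₀ _ hne]
  rfl

/-- The weighted outcome is the potential outcome restricted to the event that the individual
is treated and no peer is. -/
theorem mul_b2r_mul_prod_eq_ite {m : ℕ} (y : Bool → (Fin m → Bool) → ℝ) (d : Bool)
    (dp : Fin m → Bool) :
    y d dp * (b2r d * ∏ j, (1 - b2r (dp j))) =
      if d = true ∧ ∀ j, dp j = false then y true (fun _ => false) else 0 := by
  split_ifs with h
  · obtain ⟨rfl, h⟩ := h
    obtain rfl : dp = fun _ => false := funext h
    simp [b2r]
  · by_cases hd : d = true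
    · obtain ⟨j, hj⟩ : ∃ j, dp j ≠ false := by
        by_contra! h'
        exact h ⟨hd, h'⟩
      have : ∏ j, (1 - b2r (dp j)) = 0 :=
        Finset.prod_eq_zero (Finset.mem_univ j) (by simp [b2r, hj])
      simp [this]
    · simp [b2r, hd]

/-- Reduced-form identity for the always-taker outcome term. -/
theorem reduced_form_always_taker_outcome
    [MeasurableSpace Ω] (P : Measure Ω) [IsProbabilityMeasure P]
    (m : ℕ) (hm : 1 ≤ m)
    (Zi : Ω → Bool) (Zp : Ω → Fin m → Bool)
    (Di : Bool → Bool → Ω → Bool) (Dp : Bool → Bool → Ω → Fin m → Bool)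
    (Y : Bool → (Fin m → Bool) → Ω → ℝ)
    (hZi : Measurable Zi) (hZp : Measurable Zp)
    (hDi : ∀ z z', Measurable (Di z z')) (hDp : ∀ z z', Measurable (Dp z z'))
    (hYm : ∀ d dp, Measurable (Y d dp)) (hYint : ∀ d dp, Integrable (Y d dp) P)
    (hZpos : ∀ z z', 0 < P (ZevM Zi Zp z z'))
    -- Assumption IV: independence and own-instrument monotonicity
    (hIndep : IndepFun (fun ω => (Zi ω, Zp ω))
      (fun ω => (fun z z' => Di z z' ω, fun z z' => Dp z z' ω,
        fun d dp => Y d dp ω)) P)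
    (hIV : ∀ᵐ ω ∂P, (∀ z, Di false z ω ≤ Di true z ω) ∧
      ∀ zi j, Dp zi false ω j ≤ Dp zi true ω j)
    -- Assumption SM: monotonicity in the spillovers
    (hSM : ∀ᵐ ω ∂P, (∀ zi, Di zi false ω ≤ Di zi true ω) ∧
      ∀ z j, Dp false z ω j ≤ Dp true z ω j)
    -- Assumption IRR: irrelevance
    (hIRR : ∀ᵐ ω ∂P, (∀ z, Di true z ω = Di false z ω → Dp true z ω = Dp false z ω) ∧
      ∀ zi, Dp zi true ω = Dp zi false ω → Di zi true ω = Di zi false ω)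
    :
    dEM P Zi Zp (fun z z' ω => Y (Di z z' ω) (Dp z z' ω) ω *
        (b2r (Di z z' ω) * ∏ j, (1 - b2r (Dp z z' ω j)))) false true false false =
      -(∫ ω in {ω | Di false true ω = true ∧ Di false false ω = true ∧
          Dp false true ω ≠ Dp false false ω ∧ ∀ j, Dp false false ω j = false},
        Y true (fun _ => false) ω ∂P) := by
  let U : Ω → Bool × (Fin m → Bool) := fun ω => (Zi ω, Zp ω)
  let V : Ω → (Bool → Bool → Bool) × (Bool → Bool → Fin m → Bool) ×
      (Bool → (Fin m → Bool) → ℝ) := fun ω =>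
    (fun z z' => Di z z' ω, fun z z' => Dp z z' ω, fun d dp => Y d dp ω)
  let S : Bool → Bool → Set Ω := fun z z' => {ω | Di z z' ω = true ∧ ∀ j, Dp z z' ω j = false}
  let y : Ω → ℝ := Y true (fun _ => false)
  have hU : Measurable U := hZi.prodMk hZp
  have hV : Measurable V := by
    refine Measurable.prodMk ?_ (Measurable.prodMk ?_ ?_) <;>
      exact measurable_pi_lambda _ fun a => measurable_pi_lambda _ fun b => by
        first | exact hDi a b | exact hDp a b | exact hYm a b
  have hS : ∀ z z', MeasurableSet (S z z') := fun z z' =>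
    (hDi z z' (measurableSet_singleton true)).inter
      (hDp z z' (t := {v | ∀ j, v j = false}) (Set.toFinite _).measurableSet)
  have key : ∀ z z', cexp P (fun ω => Y (Di z z' ω) (Dp z z' ω) ω *
      (b2r (Di z z' ω) * ∏ j, (1 - b2r (Dp z z' ω j)))) (ZevM Zi Zp z z') =
      ∫ ω, (S z z').indicator y ω ∂P := by
    intro z z'
    let T : Set ((Bool → Bool → Bool) × (Bool → Bool → Fin m → Bool) ×
      (Bool → (Fin m → Bool) → ℝ)) := {q | q.1 z z' = true ∧ ∀ j, q.2.1 z z' j = false}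
    have hT : MeasurableSet T := by
      have h₁ : Measurable fun q : (Bool → Bool → Bool) × (Bool → Bool → Fin m → Bool) ×
          (Bool → (Fin m → Bool) → ℝ) => q.1 z z' := by fun_prop
      have h₂ : Measurable fun q : (Bool → Bool → Bool) × (Bool → Bool → Fin m → Bool) ×
          (Bool → (Fin m → Bool) → ℝ) => q.2.1 z z' := by fun_prop
      exact (h₁ (measurableSet_singleton true)).inter
        (h₂ (t := {v | ∀ j, v j = false}) (Set.toFinite _).measurableSet)
    have hg : Measurable (T.indicator fun q => q.2.2 true (fun _ => false)) :=
      Measurable.indicator (by fun_prop) hT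
    have hA : ZevM Zi Zp z z' = U ⁻¹' {u | u.1 = z ∧ ∀ j, u.2 j = z'} := rfl
    have hX : (fun ω => Y (Di z z' ω) (Dp z z' ω) ω *
        (b2r (Di z z' ω) * ∏ j, (1 - b2r (Dp z z' ω j)))) =
        fun ω => T.indicator (fun q => q.2.2 true (fun _ => false)) (V ω) := by
      classical
      ext ω
      rw [mul_b2r_mul_prod_eq_ite (fun d dp => Y d dp ω), Set.indicator_apply]
      rfl
    have hpos := hZpos z z'
    rw [hA] at hpos ⊢
    rw [hX, cexp_preimage_eq_integral_of_indepFun hU hV hIndep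
      (Set.toFinite _).measurableSet hpos hg]
    rfl
  have hE : MeasurableSet {ω | Di false true ω = true ∧ Di false false ω = true ∧
      Dp false true ω ≠ Dp false false ω ∧ ∀ j, Dp false false ω j = false} := by
    have h : MeasurableSet {ω | Dp false true ω = Dp false false ω} :=
      measurableSet_eq_fun (hDp _ _) (hDp _ _)
    convert (hDi false true (measurableSet_singleton true)).inter ((hS false false).inter h.compl)
      using 1
    ext ω
    simp only [S, Set.mem_ofPred_eq, Set.mem_inter_iff, Set.mem_preimage, Set.mem_compl_iff,
      Set.mem_singleton_iff]
    tauto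
  have hy : Integrable y P := hYint _ _
  rw [dEM, key, key, ← integral_sub (hy.indicator (hS _ _)) (hy.indicator (hS _ _)),
    ← integral_indicator hE, ← integral_neg]
  refine integral_congr_ae ?_
  filter_upwards [hIV, hSM, hIRR] with ω h₁ h₂ h₃
  by_cases heq : Dp false true ω = Dp false false ω
  · have hd := h₃.2 false heq
    simp only [Set.indicator, S, heq, hd, Set.mem_ofPred_eq]
    split_ifs <;> simp_all
  · have hn : ¬ ∀ j, Dp false true ω j = false := by
      intro h
      refine heq (funext fun j => ?_)
      have hj := h₁.2 false j
      rw [h j] at hj ⊢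
      exact (le_bot_iff.1 hj).symm
    have hd : Di false false ω = true → Di false true ω = true := fun h => by
      have := h₂.1 false
      rw [h] at this
      exact top_le_iff.1 this
    by_cases h₀ : Di false false ω = true
    · simp [Set.indicator, S, heq, hn, h₀, hd h₀, y]
    · simp [Set.indicator, S, hn, h₀]

end
end

section
/- First-stage identities under one-sided noncompliance. Assume Assumptions IV, SM, IRR and OSNC hold. Then: (i) Δ^{01}_{00}E[D_{i(i)}^∨] = −P(D_{(i)}(0,1) ≠ 0); and (ii) Δ^{11}_{10}E[D_i D_{(i)}^∨] = −P(D_i(1,1) = D_i(1,0) = 1, D_{(i)}(1,1) ≠ 0). -/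
open MeasureTheory ProbabilityTheory

noncomputable section

variable {Ω : Type*} {m : ℕ}

lemma cexp_eq_integral_of_indepFun {α : Type*} [MeasurableSpace Ω] [MeasurableSpace α]
    {P : Measure Ω} [IsFiniteMeasure P] {W : Ω → α} {X : Ω → ℝ} {B : Set α}
    (hW : Measurable W) (hX : Measurable X) (hB : MeasurableSet B) (hWX : IndepFun W X P)
    (hpos : 0 < P (W ⁻¹' B)) :
    cexp P X (W ⁻¹' B) = ∫ ω, X ω ∂P := by
  have hmeas : Measurable (B.indicator (1 : α → ℝ)) := measurable_one.indicator hB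
  have hind : IndepFun (fun ω => B.indicator (1 : α → ℝ) (W ω)) X P :=
    hWX.comp hmeas measurable_id
  have hmul := hind.integral_fun_mul_eq_mul_integral
    (hmeas.comp hW).aestronglyMeasurable hX.aestronglyMeasurable
  have hset : ∫ ω in W ⁻¹' B, X ω ∂P = ∫ ω, B.indicator (1 : α → ℝ) (W ω) * X ω ∂P := by
    rw [← integral_indicator (hW hB)]
    congr 1 with ω
    by_cases h : W ω ∈ B <;> simp [h]
  have hprob : ∫ ω, B.indicator (1 : α → ℝ) (W ω) ∂P = (P (W ⁻¹' B)).toReal := by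
    change _ = P.real (W ⁻¹' B)
    rw [← integral_indicator_one (hW hB)]
    rfl
  have hne : (P (W ⁻¹' B)).toReal ≠ 0 :=
    (ENNReal.toReal_pos hpos.ne' (measure_ne_top P _)).ne'
  rw [cexp, hset, hmul, hprob, mul_div_cancel_left₀ _ hne]

lemma dEM_eq_neg_measure_of_ae [MeasurableSpace Ω] {P : Measure Ω} [IsProbabilityMeasure P]
    {Zi : Ω → Bool} {Zp : Ω → Fin m → Bool} {X : Bool → Bool → Ω → ℝ} {S : Set Ω}
    {z z' w w' : Bool} (hZi : Measurable Zi) (hZp : Measurable Zp)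
    (hZpos : ∀ a b, 0 < P (ZevM Zi Zp a b)) (hX : ∀ a b, Measurable (X a b))
    (hXint : ∀ a b, Integrable (X a b) P)
    (hindep : ∀ a b, IndepFun (fun ω => (Zi ω, Zp ω)) (X a b) P) (hS : MeasurableSet S)
    (h : ∀ᵐ ω ∂P, X z z' ω - X w w' ω = -S.indicator 1 ω) :
    dEM P Zi Zp X z z' w w' = -(P S).toReal := by
  have hcexp (a b : Bool) : cexp P (X a b) (ZevM Zi Zp a b) = ∫ ω, X a b ω ∂P :=
    cexp_eq_integral_of_indepFun (B := {p : Bool × (Fin m → Bool) | p.1 = a ∧ ∀ j, p.2 j = b})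
      (hZi.prodMk hZp) (hX a b) (Set.toFinite _).measurableSet (hindep a b) (hZpos a b)
  rw [dEM, hcexp, hcexp, ← integral_sub (hXint _ _) (hXint _ _), integral_congr_ae h,
    integral_neg, integral_indicator_one hS]
  rfl

lemma b2r_true : b2r true = 1 := if_pos rfl

lemma b2r_false : b2r false = 0 := if_neg Bool.false_ne_true

lemma prod_one_sub_b2r (d : Fin m → Bool) :
    ∏ j, (1 - b2r (d j)) = if ∃ j, d j = true then 0 else 1 := by
  split_ifs with h
  · obtain ⟨j, hj⟩ := h
    exact Finset.prod_eq_zero (Finset.mem_univ j) (by simp [b2r_true, hj])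
  · push Not at h
    exact Finset.prod_eq_one fun j _ => by simp [b2r_false, h j]

/-- First-stage identities under one-sided noncompliance. -/
theorem first_stage_osnc
    [MeasurableSpace Ω] (P : Measure Ω) [IsProbabilityMeasure P]
    (m : ℕ) (hm : 1 ≤ m)
    (Zi : Ω → Bool) (Zp : Ω → Fin m → Bool)
    (Di : Bool → Bool → Ω → Bool) (Dp : Bool → Bool → Ω → Fin m → Bool)
    (Y : Bool → (Fin m → Bool) → Ω → ℝ)
    (hZi : Measurable Zi) (hZp : Measurable Zp)
    (hDi : ∀ z z', Measurable (Di z z')) (hDp : ∀ z z', Measurable (Dp z z'))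
    (hYm : ∀ d dp, Measurable (Y d dp)) (hYint : ∀ d dp, Integrable (Y d dp) P)
    (hZpos : ∀ z z', 0 < P (ZevM Zi Zp z z'))
    -- Assumption IV: independence and own-instrument monotonicity
    (hIndep : IndepFun (fun ω => (Zi ω, Zp ω))
      (fun ω => (fun z z' => Di z z' ω, fun z z' => Dp z z' ω,
        fun d dp => Y d dp ω)) P)
    (hIV : ∀ᵐ ω ∂P, (∀ z, Di false z ω ≤ Di true z ω) ∧
      ∀ zi j, Dp zi false ω j ≤ Dp zi true ω j)
    -- Assumption SM: monotonicity in the spillovers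
    (hSM : ∀ᵐ ω ∂P, (∀ zi, Di zi false ω ≤ Di zi true ω) ∧
      ∀ z j, Dp false z ω j ≤ Dp true z ω j)
    -- Assumption IRR: irrelevance
    (hIRR : ∀ᵐ ω ∂P, (∀ z, Di true z ω = Di false z ω → Dp true z ω = Dp false z ω) ∧
      ∀ zi, Dp zi true ω = Dp zi false ω → Di zi true ω = Di zi false ω)
    -- Assumption OSNC: one-sided noncompliance
    (hOSNC : ∀ᵐ ω ∂P, (∀ z, Di false z ω = false) ∧
      ∀ zi j, Dp zi false ω j = false) :
    (dEM P Zi Zp (fun z z' ω => (1 - b2r (Di z z' ω)) *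
        ∏ j, (1 - b2r (Dp z z' ω j))) false true false false =
      -(P {ω | ∃ j, Dp false true ω j = true}).toReal) ∧
    (dEM P Zi Zp (fun z z' ω => b2r (Di z z' ω) *
        ∏ j, (1 - b2r (Dp z z' ω j))) true true true false =
      -(P {ω | Di true true ω = true ∧ Di true false ω = true ∧
        ∃ j, Dp true true ω j = true}).toReal) := by
  have hpair (z z' : Bool) : Measurable fun ω => (Di z z' ω, Dp z z' ω) :=
    (hDi z z').prodMk (hDp z z')
  have hindep (φ : Bool × (Fin m → Bool) → ℝ) (z z' : Bool) :
      IndepFun (fun ω => (Zi ω, Zp ω)) (fun ω => φ (Di z z' ω, Dp z z' ω)) P := by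
    refine hIndep.comp (φ := id) (ψ := fun u : (Bool → Bool → Bool) ×
      (Bool → Bool → Fin m → Bool) × (Bool → (Fin m → Bool) → ℝ) =>
        φ (u.1 z z', u.2.1 z z')) measurable_id ?_
    exact (measurable_of_finite φ).comp (by fun_prop)
  have hmeas (φ : Bool × (Fin m → Bool) → ℝ) (z z' : Bool) :
      Measurable fun ω => φ (Di z z' ω, Dp z z' ω) :=
    (measurable_of_finite φ).comp (hpair z z')
  have hint (φ : Bool × (Fin m → Bool) → ℝ) (z z' : Bool) :
      Integrable (fun ω => φ (Di z z' ω, Dp z z' ω)) P :=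
    (Integrable.of_finite (μ := P.map fun ω => (Di z z' ω, Dp z z' ω))).comp_measurable
      (hpair z z')
  have hset (s : Set (Bool × (Fin m → Bool))) (z z' : Bool) :
      MeasurableSet {ω | (Di z z' ω, Dp z z' ω) ∈ s} :=
    hpair z z' (Set.toFinite s).measurableSet
  constructor
  · let φ : Bool × (Fin m → Bool) → ℝ := fun u => (1 - b2r u.1) * ∏ j, (1 - b2r (u.2 j))
    refine dEM_eq_neg_measure_of_ae hZi hZp hZpos (hmeas φ) (hint φ) (hindep φ)
      (hset {u | ∃ j, u.2 j = true} false true) ?_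
    filter_upwards [hOSNC] with ω ⟨hD, hDpeer⟩
    by_cases h : ∃ j, Dp false true ω j = true <;>
      simp [prod_one_sub_b2r, hD, hDpeer, h, b2r_false]
  · let φ : Bool × (Fin m → Bool) → ℝ := fun u => b2r u.1 * ∏ j, (1 - b2r (u.2 j))
    refine dEM_eq_neg_measure_of_ae hZi hZp hZpos (hmeas φ) (hint φ) (hindep φ)
      ((hset {u | u.1 = true} true true).inter ((hset {u | u.1 = true} true false).inter
        (hset {u | ∃ j, u.2 j = true} true true))) ?_
    filter_upwards [hOSNC, hSM, hIRR] with ω ⟨_, hDpeer⟩ ⟨hmono, _⟩ ⟨_, hirr⟩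
    by_cases h : ∃ j, Dp true true ω j = true
    · have hle : Di true false ω = true → Di true true ω = true := hmono true
      cases h₀ : Di true false ω
      · simp [prod_one_sub_b2r, hDpeer, h, h₀, b2r_false]
      · simp [prod_one_sub_b2r, hDpeer, h, h₀, hle h₀, b2r_true, b2r_false]
    · have heq : Di true true ω = Di true false ω := hirr true (by
        ext j
        simp [hDpeer, not_exists.mp h j])
      simp [prod_one_sub_b2r, hDpeer, h, heq, b2r_false]

end
end
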